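/- arXiv:math-ph/0405001 — 4 statements merged into one kernel-verified Lean document; each statement's English description precedes it below -/
import Mathlib

section
/- Let H be a real Hilbert space, let F : H → H be three times continuously Fréchet differentiable on the ball B(y,R₀) := {u : ‖u−y‖ ≤ R₀} with ‖F''(u)‖ ≤ M₂ and ‖F'''(u)‖ ≤ M₃ there, let F(y) = 0, and assume F is compact (continuous and mapping bounded sets to relatively compact sets). Set A := F'(y) and assume that for every ε > 0 the operator A + εI is boundedly invertible with ‖(A+εI)⁻¹‖ ≤ c/ε for a constant c > 0 independent of ε. Let w ∈ H be such that y − w = Av for some v ∈ H with ‖v‖ < 1/(2M₂c(1+c)), and set ρ := √(1 − 2M₂‖v‖c(1+c)). Then there exists ε₀ > 0 such that for every ε ∈ (0,ε₀) the equation F(u) + ε(u − w) = 0 has a solution u_ε with ‖u_ε − y‖ ≤ ε(1+ρ)/(cM₂) (so ‖u_ε − y‖ = O(ε) and ‖u_ε − y‖ → 0 as ε → 0), and the solution is unique in the ball {u : ‖u − y‖ ≤ ε(1−ρ)/(cM₂)} provided ε is sufficiently small. -/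
open Metric

/-- If the second derivative of `F` is bounded by `M` on a ball, then the first derivative is
`M`-Lipschitz at the centre of that ball. -/
lemma norm_fderiv_sub_le_of_norm_iteratedFDeriv_two_le
    {E G : Type*} [NormedAddCommGroup E] [NormedSpace ℝ E]
    [NormedAddCommGroup G] [NormedSpace ℝ G] {F : E → G} {y u : E} {R M : ℝ}
    (hF : ContDiffOn ℝ 2 F (ball y R))
    (hF2 : ∀ x ∈ ball y R, ‖iteratedFDeriv ℝ 2 F x‖ ≤ M) (hu : u ∈ ball y R) :
    ‖fderiv ℝ F u - fderiv ℝ F y‖ ≤ M * ‖u - y‖ := by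
  have hy : y ∈ ball y R := mem_ball_self (pos_of_mem_ball hu)
  refine (convex_ball y R).norm_image_sub_le_of_norm_fderiv_le (𝕜 := ℝ) (fun x hx => ?_)
    (fun x hx => ?_) hy hu
  · have h := hF.fderiv_of_isOpen isOpen_ball (m := 1) (by norm_num)
    exact (h.differentiableOn (by norm_num)).differentiableAt (isOpen_ball.mem_nhds hx)
  · rw [← norm_iteratedFDeriv_one, norm_iteratedFDeriv_fderiv]
    exact hF2 x hx

/-- The second-order Taylor estimate `‖F u - F y - F'(y) (u - y)‖ ≤ M ‖u - y‖² / 2`. -/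
lemma norm_sub_sub_fderiv_le_of_norm_iteratedFDeriv_two_le
    {E G : Type*} [NormedAddCommGroup E] [NormedSpace ℝ E]
    [NormedAddCommGroup G] [NormedSpace ℝ G] {F : E → G} {y u : E} {R M : ℝ}
    (hF : ContDiffOn ℝ 2 F (ball y R))
    (hF2 : ∀ x ∈ ball y R, ‖iteratedFDeriv ℝ 2 F x‖ ≤ M) (hu : u ∈ ball y R) :
    ‖F u - F y - fderiv ℝ F y (u - y)‖ ≤ M * ‖u - y‖ ^ 2 / 2 := by
  set z := u - y with hz
  have hmem : ∀ t ∈ Set.Icc (0 : ℝ) 1, y + t • z ∈ ball y R := fun t ht => by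
    rw [mem_ball_iff_norm] at hu ⊢
    rw [add_sub_cancel_left, norm_smul, Real.norm_of_nonneg ht.1]
    exact (mul_le_of_le_one_left (norm_nonneg _) ht.2).trans_lt hu
  have hderiv : ∀ t ∈ Set.Icc (0 : ℝ) 1,
      HasDerivAt (fun t : ℝ => F (y + t • z) - F y - t • fderiv ℝ F y z)
        (fderiv ℝ F (y + t • z) z - fderiv ℝ F y z) t := fun t ht => by
    have hd : HasFDerivAt F (fderiv ℝ F (y + t • z)) (y + t • z) :=
      ((hF.differentiableOn (by norm_num)).differentiableAt
        (isOpen_ball.mem_nhds (hmem t ht))).hasFDerivAt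
    have hl : HasDerivAt (fun t : ℝ => y + t • z) z t := by
      simpa using ((hasDerivAt_id t).smul_const z).const_add y
    have hl' : HasDerivAt (fun t : ℝ => t • fderiv ℝ F y z) (fderiv ℝ F y z) t := by
      simpa using (hasDerivAt_id t).smul_const (fderiv ℝ F y z)
    exact ((hd.comp_hasDerivAt t hl).sub_const (F y)).sub hl'
  have key := image_norm_le_of_norm_deriv_right_le_deriv_boundary
    (f := fun t : ℝ => F (y + t • z) - F y - t • fderiv ℝ F y z)
    (f' := fun t => fderiv ℝ F (y + t • z) z - fderiv ℝ F y z)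
    (a := 0) (b := 1) (B := fun t => M * ‖z‖ ^ 2 / 2 * t ^ 2)
    (B' := fun t => M * ‖z‖ ^ 2 / 2 * (2 * t))
    (fun t ht => (hderiv t ht).continuousAt.continuousWithinAt)
    (fun t ht => (hderiv t (Set.Ico_subset_Icc_self ht)).hasDerivWithinAt)
    (by simp)
    (fun t => by simpa using (hasDerivAt_pow 2 t).const_mul (M * ‖z‖ ^ 2 / 2))
    (fun t ht => by
      have ht' := Set.Ico_subset_Icc_self ht
      have h := norm_fderiv_sub_le_of_norm_iteratedFDeriv_two_le hF hF2 (hmem t ht')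
      rw [add_sub_cancel_left, norm_smul, Real.norm_of_nonneg ht.1] at h
      rw [← sub_apply]
      calc _ ≤ _ := ContinuousLinearMap.le_of_opNorm_le _ h z
        _ = _ := by ring)
    (Set.right_mem_Icc.2 zero_le_one)
  simpa [hz] using key

/-- On a closed ball of radius `δ`, the remainder `F - F'(y)` is `M δ`-Lipschitz if the second
derivative of `F` is bounded by `M`. -/
lemma norm_sub_sub_fderiv_le_mul_of_mem_closedBall
    {E G : Type*} [NormedAddCommGroup E] [NormedSpace ℝ E]
    [NormedAddCommGroup G] [NormedSpace ℝ G] {F : E → G} {y a b : E} {R M δ : ℝ}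
    (hF : ContDiffOn ℝ 2 F (ball y R)) (hM : 0 ≤ M)
    (hF2 : ∀ x ∈ ball y R, ‖iteratedFDeriv ℝ 2 F x‖ ≤ M) (hδ : δ < R)
    (ha : a ∈ closedBall y δ) (hb : b ∈ closedBall y δ) :
    ‖F a - F b - fderiv ℝ F y (a - b)‖ ≤ M * δ * ‖a - b‖ := by
  have hsub := closedBall_subset_ball (x := y) hδ
  refine (convex_closedBall y δ).norm_image_sub_le_of_norm_fderiv_le' (𝕜 := ℝ) (fun x hx => ?_)
    (fun x hx => ?_) hb ha
  · exact (hF.differentiableOn (by norm_num)).differentiableAt (isOpen_ball.mem_nhds (hsub hx))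
  · exact (norm_fderiv_sub_le_of_norm_iteratedFDeriv_two_le hF hF2 (hsub hx)).trans
      (mul_le_mul_of_nonneg_left (mem_closedBall_iff_norm.1 hx) hM)

/-- A map which is Lipschitz with constant `k < 1` on a closed ball and preserves it has a fixed
point there. -/
lemma exists_fixedPoint_mem_closedBall {E : Type*} [NormedAddCommGroup E] [CompleteSpace E]
    {T : E → E} {y : E} {δ k : ℝ} (hδ : 0 ≤ δ) (hk : 0 ≤ k) (hk1 : k < 1)
    (hT : Set.MapsTo T (closedBall y δ) (closedBall y δ))
    (hlip : ∀ a ∈ closedBall y δ, ∀ b ∈ closedBall y δ, ‖T a - T b‖ ≤ k * ‖a - b‖) :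
    ∃ u ∈ closedBall y δ, T u = u := by
  have hcon : ContractingWith ⟨k, hk⟩ (hT.restrict T _ _) :=
    ⟨hk1, LipschitzWith.of_dist_le_mul fun a b => by
      rw [Subtype.dist_eq, Subtype.dist_eq, dist_eq_norm, dist_eq_norm]
      exact hlip a a.2 b b.2⟩
  obtain ⟨u, hu, hfix, -⟩ := hcon.exists_fixedPoint' isClosed_closedBall.isComplete hT
    (mem_closedBall_self hδ) (edist_ne_top _ _)
  exact ⟨u, hu, hfix⟩

/-- **A nonlinear singular perturbation problem (Theorem 2.1).**
If `F` is `C³` on a ball around `y` with `‖F''‖ ≤ M₂`, `‖F'''‖ ≤ M₃` there, `F y = 0`,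
`F` is compact, `A := F'(y)` satisfies the resolvent estimate `‖(A+εI)⁻¹‖ ≤ c/ε` for all
`ε > 0`, and `y - w = A v` with `‖v‖ < 1/(2M₂c(1+c))`, then (with
`ρ := √(1 - 2M₂‖v‖c(1+c))`) for all sufficiently small `ε > 0` the equation
`F(u) + ε(u - w) = 0` has a solution `u_ε` with `‖u_ε - y‖ ≤ ε(1+ρ)/(cM₂)`, unique in the
ball of radius `ε(1-ρ)/(cM₂)` about `y`. -/
theorem singular_perturbation_existence_uniqueness
    {H : Type*} [NormedAddCommGroup H] [InnerProductSpace ℝ H] [CompleteSpace H]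
    (F : H → H) (y v w : H) (R₀ M₂ M₃ c : ℝ)
    (hR₀ : 0 < R₀) (hM₂ : 0 < M₂) (hc : 0 < c)
    (hF : ContDiffOn ℝ 3 F (closedBall y R₀))
    (hF2 : ∀ u ∈ closedBall y R₀, ‖iteratedFDeriv ℝ 2 F u‖ ≤ M₂)
    (hF3 : ∀ u ∈ closedBall y R₀, ‖iteratedFDeriv ℝ 3 F u‖ ≤ M₃)
    (hFy : F y = 0)
    (hFcont : Continuous F)
    (hFcpt : ∀ s : Set H, Bornology.IsBounded s → IsCompact (closure (F '' s)))
    (A : H →L[ℝ] H) (hA : A = fderiv ℝ F y)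
    (hres : ∀ ε : ℝ, 0 < ε → ∃ B : H →L[ℝ] H,
      B.comp (A + ε • ContinuousLinearMap.id ℝ H) = ContinuousLinearMap.id ℝ H ∧
      (A + ε • ContinuousLinearMap.id ℝ H).comp B = ContinuousLinearMap.id ℝ H ∧
      ‖B‖ ≤ c / ε)
    (hw : y - w = A v)
    (hv : ‖v‖ < 1 / (2 * M₂ * c * (1 + c))) :
    ∃ ε₀ > 0, ∀ ε : ℝ, ε ∈ Set.Ioo 0 ε₀ →
      (∃ u : H, F u + ε • (u - w) = 0 ∧
        ‖u - y‖ ≤ ε * (1 + Real.sqrt (1 - 2 * M₂ * ‖v‖ * c * (1 + c))) / (c * M₂)) ∧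
      (∀ u₁ u₂ : H,
        ‖u₁ - y‖ ≤ ε * (1 - Real.sqrt (1 - 2 * M₂ * ‖v‖ * c * (1 + c))) / (c * M₂) →
        F u₁ + ε • (u₁ - w) = 0 →
        ‖u₂ - y‖ ≤ ε * (1 - Real.sqrt (1 - 2 * M₂ * ‖v‖ * c * (1 + c))) / (c * M₂) →
        F u₂ + ε • (u₂ - w) = 0 → u₁ = u₂) := by
  set ρ := Real.sqrt (1 - 2 * M₂ * ‖v‖ * c * (1 + c)) with hρ
  have hρarg : 0 < 1 - 2 * M₂ * ‖v‖ * c * (1 + c) := by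
    rw [lt_div_iff₀ (by positivity)] at hv
    linarith
  have hρ0 : 0 < ρ := Real.sqrt_pos.2 hρarg
  have hρsq : ρ ^ 2 = 1 - 2 * M₂ * ‖v‖ * c * (1 + c) := Real.sq_sqrt hρarg.le
  have hρ1 : ρ ≤ 1 := Real.sqrt_le_one.2 (sub_le_self _ (by positivity))
  refine ⟨R₀ * (c * M₂), by positivity, fun ε ⟨hε, hεlt⟩ => ?_⟩
  obtain ⟨B, hBA, hAB, hB⟩ := hres ε hε
  replace hBA : ∀ x, B (A x) + ε • B x = x := fun x => by
    simpa using DFunLike.congr_fun hBA x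
  replace hAB : ∀ x, A (B x) + ε • B x = x := fun x => by
    simpa using DFunLike.congr_fun hAB x
  set δ := ε * (1 - ρ) / (c * M₂) with hδ
  have hδ0 : 0 ≤ δ := by
    have := sub_nonneg.2 hρ1
    positivity
  have hδeq : δ * (c * M₂) = ε * (1 - ρ) := by
    rw [hδ]; field_simp
  have hδR : δ < R₀ := by
    rw [hδ, div_lt_iff₀ (by positivity)]
    nlinarith
  have hF' : ContDiffOn ℝ 2 F (ball y R₀) := (hF.mono ball_subset_closedBall).of_le (by norm_num)
  have hF2' : ∀ x ∈ ball y R₀, ‖iteratedFDeriv ℝ 2 F x‖ ≤ M₂ := fun x hx =>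
    hF2 x (ball_subset_closedBall hx)
  set T : H → H := fun u => u - B (F u + ε • (u - w)) with hT
  have hfix : ∀ u, T u = u ↔ F u + ε • (u - w) = 0 := fun u => by
    rw [hT, sub_eq_self]
    refine ⟨fun h => ?_, fun h => by rw [h, map_zero]⟩
    simpa [h] using (hAB (F u + ε • (u - w))).symm
  have hlip : ∀ a ∈ closedBall y δ, ∀ b ∈ closedBall y δ, ‖T a - T b‖ ≤ (1 - ρ) * ‖a - b‖ := by
    intro a ha b hb
    have hrem := norm_sub_sub_fderiv_le_mul_of_mem_closedBall hF' hM₂.le hF2' hδR ha hb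
    rw [← hA] at hrem
    have hTab : T a - T b = -B (F a - F b - A (a - b)) := by
      have h := hBA (a - b)
      simp only [hT, map_sub, map_add, map_smul, smul_sub] at h ⊢
      linear_combination (norm := module) -h
    rw [hTab, norm_neg]
    calc _ ≤ c / ε * ‖F a - F b - A (a - b)‖ := B.le_of_opNorm_le hB _
      _ ≤ c / ε * (M₂ * δ * ‖a - b‖) := by gcongr
      _ = δ * (c * M₂) / ε * ‖a - b‖ := by ring
      _ = (1 - ρ) * ‖a - b‖ := by rw [hδeq, mul_div_cancel_left₀ _ hε.ne']
  have hmaps : Set.MapsTo T (closedBall y δ) (closedBall y δ) := by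
    intro u hu
    have hrem := norm_sub_sub_fderiv_le_of_norm_iteratedFDeriv_two_le hF' hF2'
      (closedBall_subset_ball hδR hu)
    rw [← hA, hFy, sub_zero] at hrem
    rw [mem_closedBall_iff_norm] at hu ⊢
    have hTu : T u - y = -(B (F u - A (u - y)) + ε • (v - ε • B v)) := by
      have h := hBA (u - y)
      have hBv : v - ε • B v = B (A v) := by rw [sub_eq_iff_eq_add, hBA]
      rw [hBv, ← hw]
      simp only [hT, map_sub, map_add, map_smul, smul_sub] at h ⊢
      linear_combination (norm := module) -h
    have h1 : ‖B (F u - A (u - y))‖ ≤ c / ε * (M₂ * δ ^ 2 / 2) :=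
      (B.le_of_opNorm_le hB _).trans (by
        gcongr
        exact hrem.trans (by gcongr))
    have h2 : ‖ε • (v - ε • B v)‖ ≤ ε * ((1 + c) * ‖v‖) := by
      rw [norm_smul, Real.norm_of_nonneg hε.le]
      gcongr
      calc _ ≤ ‖v‖ + ‖ε • B v‖ := norm_sub_le _ _
        _ ≤ ‖v‖ + ε * (c / ε * ‖v‖) := by
          rw [norm_smul, Real.norm_of_nonneg hε.le]
          gcongr
          exact B.le_of_opNorm_le hB v
        _ = _ := by field_simp
    rw [hTu, norm_neg]
    calc _ ≤ _ := norm_add_le _ _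
      _ ≤ c / ε * (M₂ * δ ^ 2 / 2) + ε * ((1 + c) * ‖v‖) := add_le_add h1 h2
      _ = δ := by
        rw [hδ]
        field_simp
        linear_combination hρsq
  refine ⟨?_, fun u₁ u₂ hu₁ h₁ hu₂ h₂ => ?_⟩
  · obtain ⟨u, hu, hTu⟩ := exists_fixedPoint_mem_closedBall hδ0 (sub_nonneg.2 hρ1)
      (sub_lt_self 1 hρ0) hmaps hlip
    refine ⟨u, (hfix u).1 hTu, (mem_closedBall_iff_norm.1 hu).trans ?_⟩
    rw [hδ]
    gcongr
    linarith
  · have h := hlip u₁ (mem_closedBall_iff_norm.2 hu₁) u₂ (mem_closedBall_iff_norm.2 hu₂)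
    rw [(hfix u₁).2 h₁, (hfix u₂).2 h₂] at h
    rw [← sub_eq_zero, ← norm_le_zero_iff]
    nlinarith [norm_nonneg (u₁ - u₂)]
end

section
/- Let H be a real Hilbert space, let F : H → H be three times continuously Fréchet differentiable on B(y,R₀) with ‖F''(u)‖ ≤ M₂ there, F(y) = 0, and F compact (continuous, mapping bounded sets to relatively compact sets). Set A := F'(y), K(z) := F(y+z) − Az, and assume ‖(A+εI)⁻¹‖ ≤ c/ε for all ε > 0 with c independent of ε. Let y − w = Av with ‖v‖ < 1/(2M₂c(1+c)), and set ρ := √(1 − 2M₂‖v‖c(1+c)). Then for every sufficiently small ε > 0 and every R with ε(1−ρ)/(cM₂) ≤ R ≤ ε(1+ρ)/(cM₂), the map T(z) := −(A+εI)⁻¹K(z) − ε(A+εI)⁻¹(y−w) maps the ball {z : ‖z‖ ≤ R} into itself and has a fixed point z_ε in that ball; consequently u_ε := y + z_ε solves F(u_ε) + ε(u_ε − w) = 0 and ‖u_ε − y‖ ≤ R. -/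
open Metric

section TaylorBounds

variable {E G : Type*} [NormedAddCommGroup E] [NormedSpace ℝ E]
  [NormedAddCommGroup G] [NormedSpace ℝ G] {F : E → G} {y z z' : E} {r M : ℝ}

theorem norm_fderiv_add_sub_fderiv_le (hF : ContDiffOn ℝ 2 F (ball y r))
    (hM : ∀ u ∈ ball y r, ‖iteratedFDeriv ℝ 2 F u‖ ≤ M) (hz : ‖z‖ < r) :
    ‖fderiv ℝ F (y + z) - fderiv ℝ F y‖ ≤ M * ‖z‖ := by
  have hdiff : ∀ u ∈ ball y r, DifferentiableAt ℝ (fderiv ℝ F) u := fun u hu =>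
    ((hF.contDiffAt (isOpen_ball.mem_nhds hu)).fderiv_right (m := 1) (by norm_num)).differentiableAt
      (by norm_num)
  have hbound : ∀ u ∈ ball y r, ‖fderiv ℝ (fderiv ℝ F) u‖ ≤ M := fun u hu => by
    rw [← norm_iteratedFDeriv_one, norm_iteratedFDeriv_fderiv]
    exact hM u hu
  have hr : 0 < r := (norm_nonneg z).trans_lt hz
  simpa using (convex_ball y r).norm_image_sub_le_of_norm_fderiv_le hdiff hbound
    (mem_ball_self hr) (y := y + z) (by simpa using hz)

theorem hasFDerivAt_taylor_remainder (hF : ContDiffOn ℝ 2 F (ball y r)) (hz : ‖z‖ < r) :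
    HasFDerivAt (fun x => F (y + x) - fderiv ℝ F y x)
      (fderiv ℝ F (y + z) - fderiv ℝ F y) z := by
  have hmem : y + z ∈ ball y r := by simpa using hz
  have hd : DifferentiableAt ℝ F (y + z) :=
    (hF.contDiffAt (isOpen_ball.mem_nhds hmem)).differentiableAt (by norm_num)
  have hcomp : HasFDerivAt (fun x => F (y + x)) (fderiv ℝ F (y + z)) z := by
    rw [hasFDerivAt_comp_add_left]
    exact hd.hasFDerivAt
  exact hcomp.sub (fderiv ℝ F y).hasFDerivAt

theorem norm_taylor_remainder_sub_le (hF : ContDiffOn ℝ 2 F (ball y r))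
    (hM : ∀ u ∈ ball y r, ‖iteratedFDeriv ℝ 2 F u‖ ≤ M) (hM₀ : 0 ≤ M) {s : ℝ} (hs : s < r)
    (hz : ‖z‖ ≤ s) (hz' : ‖z'‖ ≤ s) :
    ‖(F (y + z) - fderiv ℝ F y z) - (F (y + z') - fderiv ℝ F y z')‖ ≤ M * s * ‖z - z'‖ := by
  refine (convex_closedBall (0 : E) s).norm_image_sub_le_of_norm_hasFDerivWithin_le
    (f := fun x => F (y + x) - fderiv ℝ F y x)
    (f' := fun x => fderiv ℝ F (y + x) - fderiv ℝ F y)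
    (fun x hx => (hasFDerivAt_taylor_remainder hF ?_).hasFDerivWithinAt)
    (fun x hx => (norm_fderiv_add_sub_fderiv_le hF hM ?_).trans ?_) (by simpa using hz')
    (by simpa using hz)
  · exact (mem_closedBall_zero_iff.1 hx).trans_lt hs
  · exact (mem_closedBall_zero_iff.1 hx).trans_lt hs
  · exact mul_le_mul_of_nonneg_left (mem_closedBall_zero_iff.1 hx) hM₀

theorem norm_taylor_remainder_le (hF : ContDiffOn ℝ 2 F (ball y r))
    (hM : ∀ u ∈ ball y r, ‖iteratedFDeriv ℝ 2 F u‖ ≤ M) (hFy : F y = 0) (hz : ‖z‖ < r) :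
    ‖F (y + z) - fderiv ℝ F y z‖ ≤ M / 2 * ‖z‖ ^ 2 := by
  have hsmall : ∀ t ∈ Set.Icc (0 : ℝ) 1, ‖t • z‖ < r := fun t ht => by
    rw [norm_smul, Real.norm_of_nonneg ht.1]
    exact (mul_le_of_le_one_left (norm_nonneg z) ht.2).trans_lt hz
  have hderiv : ∀ t ∈ Set.Icc (0 : ℝ) 1,
      HasDerivAt (fun t : ℝ => F (y + t • z) - fderiv ℝ F y (t • z))
        ((fderiv ℝ F (y + t • z) - fderiv ℝ F y) z) t := fun t ht => by
    have hline : HasDerivAt (fun t : ℝ => t • z) z t := by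
      simpa using (hasDerivAt_id t).smul_const z
    exact (hasFDerivAt_taylor_remainder hF (hsmall t ht)).comp_hasDerivAt t hline
  have hquad : ∀ t : ℝ, HasDerivAt (fun t : ℝ => M / 2 * ‖z‖ ^ 2 * t ^ 2)
      (M * ‖z‖ ^ 2 * t) t := fun t => by
    refine ((hasDerivAt_pow 2 t).const_mul (M / 2 * ‖z‖ ^ 2)).congr_deriv ?_
    push_cast
    ring
  have key := image_norm_le_of_norm_deriv_right_le_deriv_boundary (a := 0) (b := 1)
    (fun t ht => (hderiv t ht).continuousAt.continuousWithinAt)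
    (fun t ht => (hderiv t (Set.Ico_subset_Icc_self ht)).hasDerivWithinAt)
    (by simp [hFy]) hquad
    (fun t ht => by
      have h := norm_fderiv_add_sub_fderiv_le hF hM (hsmall t (Set.Ico_subset_Icc_self ht))
      refine (ContinuousLinearMap.le_opNorm _ z).trans
        ((mul_le_mul_of_nonneg_right h (norm_nonneg z)).trans_eq ?_)
      rw [norm_smul, Real.norm_of_nonneg ht.1]
      ring)
    (Set.right_mem_Icc.2 zero_le_one)
  simpa using key

end TaylorBounds

theorem exists_fixedPoint_closedBall_of_dist_le {X : Type*} [MetricSpace X] [CompleteSpace X]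
    {f : X → X} {x₀ : X} {r q : ℝ} (hr : 0 ≤ r) (hq₀ : 0 ≤ q) (hq : q < 1)
    (hmaps : Set.MapsTo f (closedBall x₀ r) (closedBall x₀ r))
    (hf : ∀ x ∈ closedBall x₀ r, ∀ x' ∈ closedBall x₀ r, dist (f x) (f x') ≤ q * dist x x') :
    ∃ x ∈ closedBall x₀ r, f x = x := by
  have hcontr : ContractingWith ⟨q, hq₀⟩ (hmaps.restrict f _ _) :=
    ⟨by exact_mod_cast hq, LipschitzWith.of_dist_le_mul fun x x' => hf x x.2 x' x'.2⟩
  obtain ⟨x, hx, hfix, -⟩ := hcontr.exists_fixedPoint' isClosed_closedBall.isComplete hmaps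
    (mem_closedBall_self hr) (edist_ne_top _ _)
  exact ⟨x, hx, hfix⟩

/-- **Existence part of Theorem 2.1 via the Schauder fixed point theorem.**
Under the hypotheses of Theorem 2.1, for all sufficiently small `ε > 0` and every radius `R`
with `ε(1-ρ)/(cM₂) ≤ R ≤ ε(1+ρ)/(cM₂)`, the map
`T(z) = -(A+εI)⁻¹ K(z) - ε (A+εI)⁻¹ (y - w)` maps the closed ball of radius `R` into itself
and has a fixed point `z_ε` there; `u_ε := y + z_ε` then solves `F(u_ε) + ε(u_ε - w) = 0`. -/
theorem singular_perturbation_fixed_point_existence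
    {H : Type*} [NormedAddCommGroup H] [InnerProductSpace ℝ H] [CompleteSpace H]
    (F : H → H) (y v w : H) (R₀ M₂ c : ℝ)
    (hR₀ : 0 < R₀) (hM₂ : 0 < M₂) (hc : 0 < c)
    (hF : ContDiffOn ℝ 3 F (closedBall y R₀))
    (hF2 : ∀ u ∈ closedBall y R₀, ‖iteratedFDeriv ℝ 2 F u‖ ≤ M₂)
    (hFy : F y = 0)
    (hFcont : Continuous F)
    (hFcpt : ∀ s : Set H, Bornology.IsBounded s → IsCompact (closure (F '' s)))
    (A : H →L[ℝ] H) (hA : A = fderiv ℝ F y)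
    (K : H → H) (hK : ∀ z : H, K z = F (y + z) - A z)
    (B : ℝ → H →L[ℝ] H)
    (hB : ∀ ε : ℝ, 0 < ε →
      (B ε).comp (A + ε • ContinuousLinearMap.id ℝ H) = ContinuousLinearMap.id ℝ H ∧
      (A + ε • ContinuousLinearMap.id ℝ H).comp (B ε) = ContinuousLinearMap.id ℝ H ∧
      ‖B ε‖ ≤ c / ε)
    (hw : y - w = A v)
    (hv : ‖v‖ < 1 / (2 * M₂ * c * (1 + c))) :
    ∃ ε₀ > 0, ∀ ε : ℝ, ε ∈ Set.Ioo 0 ε₀ → ∀ R : ℝ,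
      ε * (1 - Real.sqrt (1 - 2 * M₂ * ‖v‖ * c * (1 + c))) / (c * M₂) ≤ R →
      R ≤ ε * (1 + Real.sqrt (1 - 2 * M₂ * ‖v‖ * c * (1 + c))) / (c * M₂) →
      (∀ z : H, ‖z‖ ≤ R → ‖-(B ε) (K z) - ε • (B ε) (y - w)‖ ≤ R) ∧
      ∃ z : H, ‖z‖ ≤ R ∧ z = -(B ε) (K z) - ε • (B ε) (y - w) ∧
        F (y + z) + ε • (y + z - w) = 0 := by
  set p := Real.sqrt (1 - 2 * M₂ * ‖v‖ * c * (1 + c)) with hp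
  have hcM : 0 < c * M₂ := mul_pos hc hM₂
  have hdisc : 0 < 1 - 2 * M₂ * ‖v‖ * c * (1 + c) := by
    rw [lt_div_iff₀ (by positivity)] at hv
    linarith
  have hp₀ : 0 < p := Real.sqrt_pos.2 hdisc
  have hp_sq : p ^ 2 = 1 - 2 * M₂ * ‖v‖ * c * (1 + c) := Real.sq_sqrt hdisc.le
  have hp₁ : p ≤ 1 := Real.sqrt_le_one.2 (sub_le_self _ (by positivity))
  have hF' : ContDiffOn ℝ 2 F (ball y R₀) := (hF.mono ball_subset_closedBall).of_le (by norm_num)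
  have hM : ∀ u ∈ ball y R₀, ‖iteratedFDeriv ℝ 2 F u‖ ≤ M₂ :=
    fun u hu => hF2 u (ball_subset_closedBall hu)
  refine ⟨R₀ * (c * M₂) / 2, by positivity, fun ε ⟨hε, hε₀⟩ R hRl hRu => ?_⟩
  obtain ⟨hBl, hBr, hBn⟩ := hB ε hε
  rw [div_le_iff₀ hcM] at hRl
  rw [le_div_iff₀ hcM] at hRu
  have hBv : ‖B ε (y - w)‖ ≤ (1 + c) * ‖v‖ := by
    have h : B ε (A v) = v - ε • B ε v := by
      have := congrArg (· v) hBl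
      simp only [ContinuousLinearMap.comp_apply, _root_.add_apply,
        _root_.smul_apply, ContinuousLinearMap.id_apply, map_add, map_smul] at this
      exact eq_sub_of_add_eq this
    have h' : ‖ε • B ε v‖ ≤ c * ‖v‖ := by
      rw [norm_smul, Real.norm_of_nonneg hε.le]
      calc ε * ‖B ε v‖ ≤ ε * (c / ε * ‖v‖) := by
            gcongr
            exact (B ε).le_of_opNorm_le hBn v
        _ = c * ‖v‖ := by field_simp
    rw [hw, h]
    linarith [norm_sub_le v (ε • B ε v)]
  have hlt : ∀ S, S * (c * M₂) ≤ ε * (1 + p) → S < R₀ := fun S hS => by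
    refine lt_of_mul_lt_mul_right (a := c * M₂) ?_ hcM.le
    nlinarith
  have hself : ∀ S, ε * (1 - p) ≤ S * (c * M₂) → S * (c * M₂) ≤ ε * (1 + p) →
      ∀ z : H, ‖z‖ ≤ S → ‖-(B ε) (K z) - ε • (B ε) (y - w)‖ ≤ S := by
    intro S hSl hSu z hz
    have hKz : ‖K z‖ ≤ M₂ / 2 * S ^ 2 := by
      rw [hK, hA]
      refine (norm_taylor_remainder_le hF' hM hFy (hz.trans_lt (hlt S hSu))).trans ?_
      gcongr
    have hquad : c / ε * (M₂ / 2 * S ^ 2) + ε * ((1 + c) * ‖v‖) ≤ S := by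
      have h : (S * (c * M₂)) ^ 2 + ε ^ 2 * (2 * M₂ * ‖v‖ * c * (1 + c))
          ≤ 2 * ε * (S * (c * M₂)) := by
        nlinarith [mul_nonneg (sub_nonneg.2 hSl) (sub_nonneg.2 hSu)]
      have h' : c / ε * (M₂ / 2 * S ^ 2) + ε * ((1 + c) * ‖v‖) =
          ((S * (c * M₂)) ^ 2 + ε ^ 2 * (2 * M₂ * ‖v‖ * c * (1 + c))) / (2 * ε * (c * M₂)) := by
        field_simp
      rw [h', div_le_iff₀ (by positivity)]
      linarith
    calc ‖-(B ε) (K z) - ε • (B ε) (y - w)‖ ≤ ‖B ε (K z)‖ + ε * ‖B ε (y - w)‖ := by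
          refine (norm_sub_le _ _).trans_eq ?_
          rw [norm_neg, norm_smul, Real.norm_of_nonneg hε.le]
      _ ≤ c / ε * (M₂ / 2 * S ^ 2) + ε * ((1 + c) * ‖v‖) := by
          gcongr
          exact (B ε).le_of_opNorm_le_of_le hBn hKz
      _ ≤ S := hquad
  refine ⟨hself R hRl hRu, ?_⟩
  -- On the smallest admissible ball the map is a contraction with constant `1 - p`.
  set S := ε * (1 - p) / (c * M₂) with hS
  have hSeq : S * (c * M₂) = ε * (1 - p) := div_mul_cancel₀ _ hcM.ne'
  have hS₀ : 0 ≤ S := div_nonneg (mul_nonneg hε.le (sub_nonneg.2 hp₁)) hcM.le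
  have hSu : S * (c * M₂) ≤ ε * (1 + p) := by nlinarith
  have hSR : S ≤ R := le_of_mul_le_mul_right (hSeq.trans_le hRl) hcM
  obtain ⟨z, hz, hfix⟩ := exists_fixedPoint_closedBall_of_dist_le
    (f := fun z => -(B ε) (K z) - ε • (B ε) (y - w)) (x₀ := 0) hS₀
    (sub_nonneg.2 hp₁) (sub_lt_self 1 hp₀)
    (fun z hz => mem_closedBall_zero_iff.2
      (hself S hSeq.ge hSu z (mem_closedBall_zero_iff.1 hz)))
    (fun z hz z' hz' => by
      rw [mem_closedBall_zero_iff] at hz hz'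
      have hKsub : ‖K z - K z'‖ ≤ M₂ * S * ‖z - z'‖ := by
        rw [hK, hK, hA]
        exact norm_taylor_remainder_sub_le hF' hM hM₂.le (hlt S hSu) hz hz'
      rw [dist_sub_right, dist_neg_neg, dist_eq_norm, dist_eq_norm, ← map_sub]
      refine ((B ε).le_of_opNorm_le_of_le hBn hKsub).trans_eq ?_
      calc c / ε * (M₂ * S * ‖z - z'‖) = S * (c * M₂) / ε * ‖z - z'‖ := by ring
        _ = (1 - p) * ‖z - z'‖ := by rw [hSeq, mul_div_cancel_left₀ _ hε.ne'])
  refine ⟨z, (mem_closedBall_zero_iff.1 hz).trans hSR, hfix.symm, ?_⟩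
  have hinv : ∀ x, A (B ε x) + ε • B ε x = x := fun x => by
    simpa using congrArg (· x) hBr
  have hAz : A z + ε • z = -K z - ε • (y - w) := by
    have h : z = B ε (-K z - ε • (y - w)) := by
      rw [map_sub, map_neg, map_smul]
      exact hfix.symm
    have h' := hinv (-K z - ε • (y - w))
    rwa [← h] at h'
  have hFz : F (y + z) = K z + A z := by rw [hK, sub_add_cancel]
  calc F (y + z) + ε • (y + z - w) = K z + (A z + ε • z) + ε • (y - w) := by
        rw [hFz]
        module
    _ = 0 := by
        rw [hAz]
        abel
end

section
/- Let H be a real Hilbert space, let F : H → H be twice continuously Fréchet differentiable on a ball B(y,R₀) with ‖F''(u)‖ ≤ M₂ there, let F(y) = 0, and assume A := F'(y) is an isomorphism of H onto H (i.e., A is bounded and boundedly invertible). Then for every w ∈ H there exist ε₀ > 0, C > 0, and r > 0 such that for every ε ∈ (0,ε₀) the equation F(u) + ε(u − w) = 0 has a unique solution u_ε in the ball {u : ‖u − y‖ ≤ r}, and ‖u_ε − y‖ ≤ Cε. -/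
open Metric

open scoped NNReal

section ApproximatesLinearOn

variable {E : Type*} [NormedAddCommGroup E] [NormedSpace ℝ E]

lemma ApproximatesLinearOn.add_smul_sub {f : E → E} {f' : E →L[ℝ] E} {s : Set E} {c d : ℝ≥0}
    (hf : ApproximatesLinearOn f f' s c) {t : ℝ} (ht : ‖t‖ ≤ d) (w : E) :
    ApproximatesLinearOn (fun u => f u + t • (u - w)) f' s (c + d) := by
  intro a ha b hb
  calc ‖f a + t • (a - w) - (f b + t • (b - w)) - f' (a - b)‖
      = ‖(f a - f b - f' (a - b)) + t • (a - b)‖ := by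
        congr 1
        module
    _ ≤ ‖f a - f b - f' (a - b)‖ + ‖t‖ * ‖a - b‖ := by
        rw [← norm_smul]
        exact norm_add_le _ _
    _ ≤ c * ‖a - b‖ + d * ‖a - b‖ := by
        gcongr
        exact hf a ha b hb
    _ = ↑(c + d) * ‖a - b‖ := by
        push_cast
        ring

/-- A map that approximates a linear isomorphism `e` with a constant at most half of the lower
bound `N⁻¹` of `e` expands distances by at least `(2 * N)⁻¹`. -/
lemma ApproximatesLinearOn.norm_sub_le_two_mul {f : E → E} {e : E ≃L[ℝ] E} {s : Set E}
    {c N : ℝ≥0} (hf : ApproximatesLinearOn f (e : E →L[ℝ] E) s c)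
    (hN : ∀ z, ‖e.symm z‖ ≤ N * ‖z‖) (hc : (N : ℝ) * c ≤ 1 / 2)
    {a b : E} (ha : a ∈ s) (hb : b ∈ s) :
    ‖a - b‖ ≤ 2 * N * ‖f a - f b‖ := by
  have h : ‖e (a - b)‖ ≤ ‖f a - f b‖ + c * ‖a - b‖ :=
    calc ‖e (a - b)‖ = ‖(f a - f b) - (f a - f b - e (a - b))‖ := by rw [sub_sub_cancel]
      _ ≤ ‖f a - f b‖ + ‖f a - f b - e (a - b)‖ := norm_sub_le _ _
      _ ≤ ‖f a - f b‖ + c * ‖a - b‖ := by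
        gcongr
        exact hf a ha b hb
  have h' := hN (e (a - b))
  rw [e.symm_apply_apply] at h'
  have hmul := mul_le_mul_of_nonneg_left h N.coe_nonneg
  have hc' := mul_le_mul_of_nonneg_right hc (norm_nonneg (a - b))
  linarith

end ApproximatesLinearOn

/-- **The classical (regular) case.** If `F` is `C²` near `y` with `‖F''‖ ≤ M₂`, `F y = 0`,
and `A := F'(y)` is an isomorphism of `H` onto `H`, then for every `w` and all sufficiently
small `ε > 0` the equation `F(u) + ε(u - w) = 0` has a unique solution in a small ball
around `y`, and this solution satisfies `‖u_ε - y‖ ≤ Cε`. -/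
theorem singular_perturbation_regular_case
    {H : Type*} [NormedAddCommGroup H] [InnerProductSpace ℝ H] [CompleteSpace H]
    (F : H → H) (y : H) (R₀ M₂ : ℝ) (hR₀ : 0 < R₀)
    (hF : ContDiffOn ℝ 2 F (closedBall y R₀))
    (hM₂ : ∀ u ∈ closedBall y R₀, ‖iteratedFDeriv ℝ 2 F u‖ ≤ M₂)
    (hFy : F y = 0)
    (e : H ≃L[ℝ] H) (he : (e : H →L[ℝ] H) = fderiv ℝ F y) :
    ∀ w : H, ∃ ε₀ > 0, ∃ C > 0, ∃ r > 0, ∀ ε : ℝ, ε ∈ Set.Ioo 0 ε₀ →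
      ∃ u : H, (‖u - y‖ ≤ r ∧ F u + ε • (u - w) = 0 ∧ ‖u - y‖ ≤ C * ε) ∧
        ∀ u' : H, ‖u' - y‖ ≤ r → F u' + ε • (u' - w) = 0 → u' = u := by
  intro w
  have hC : ContDiffAt ℝ 2 F y := hF.contDiffAt (closedBall_mem_nhds y hR₀)
  have hS : HasStrictFDerivAt F (e : H →L[ℝ] H) y := he ▸ hC.hasStrictFDerivAt two_ne_zero
  set N : ℝ≥0 := ‖(e.symm : H →L[ℝ] H)‖₊ + 1 with hN
  have hN0 : 0 < N := by positivity
  have hN0' : (0 : ℝ) < N := hN0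
  have hNe : ∀ z, ‖e.symm z‖ ≤ N * ‖z‖ := fun z =>
    (e.symm : H →L[ℝ] H).le_of_opNorm_le (by simp [hN]) z
  have hc0 : 0 < (4 * N)⁻¹ := by positivity
  obtain ⟨s, hs, hFs⟩ := hS.approximates_deriv_on_nhds (Or.inr hc0)
  obtain ⟨r, hr, hrs⟩ := nhds_basis_closedBall.mem_iff.1 hs
  let inv : (e : H →L[ℝ] H).NonlinearRightInverse :=
    { toFun := e.symm
      nnnorm := N
      bound' := hNe
      right_inv' := e.apply_symm_apply }
  refine ⟨min (4 * N : ℝ)⁻¹ (r / (2 * N * (‖y - w‖ + 1))), by positivity,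
    2 * N * ‖y - w‖ + 1, by positivity, r, hr, fun ε ⟨hε, hε'⟩ => ?_⟩
  obtain ⟨hε₁, hε₂⟩ := lt_min_iff.1 hε'
  have hG := (hFs.mono_set hrs).add_smul_sub (t := ε) (d := (4 * N)⁻¹)
    (by simpa [abs_of_pos hε] using hε₁.le) w
  have hGy : F y + ε • (y - w) = ε • (y - w) := by rw [hFy, zero_add]
  have hc : (N : ℝ) * ↑((4 * N)⁻¹ + (4 * N)⁻¹ : ℝ≥0) ≤ 1 / 2 := by
    push_cast
    field_simp
    norm_num
  have hinj {a b : H} (ha : a ∈ closedBall y r) (hb : b ∈ closedBall y r) :=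
    hG.norm_sub_le_two_mul hNe hc ha hb
  have hrad : ε * ‖y - w‖ ≤ ((N : ℝ)⁻¹ - ↑((4 * N)⁻¹ + (4 * N)⁻¹ : ℝ≥0)) * r := by
    rw [lt_div_iff₀ (by positivity)] at hε₂
    have hhalf : (N : ℝ)⁻¹ - ↑((4 * N)⁻¹ + (4 * N)⁻¹ : ℝ≥0) = (2 * N : ℝ)⁻¹ := by
      push_cast
      field_simp
      norm_num
    rw [hhalf, inv_mul_eq_div, le_div_iff₀ (by positivity)]
    nlinarith [mul_pos hε hN0']
  obtain ⟨u, hu, hu0⟩ := hG.surjOn_closedBall_of_nonlinearRightInverse inv hr.le subset_rfl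
    (show (0 : H) ∈ _ by
      rw [mem_closedBall, dist_zero_left, hGy, norm_smul, Real.norm_of_nonneg hε.le]
      exact hrad)
  refine ⟨u, ⟨mem_closedBall_iff_norm.1 hu, hu0, ?_⟩, fun u' hu' hu'0 => ?_⟩
  · have h := hinj hu (mem_closedBall_self hr.le)
    simp only at hu0
    rw [hu0, hGy, zero_sub, norm_neg, norm_smul, Real.norm_of_nonneg hε.le] at h
    linarith
  · have h := hinj (mem_closedBall_iff_norm.2 hu') hu
    simp only at hu0
    rw [hu0, hu'0, sub_zero, norm_zero, mul_zero] at h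
    exact sub_eq_zero.1 (norm_le_zero_iff.1 h)
end

section
/- Let X be a real Banach space, let F : X → X be a map satisfying ‖F(u)‖ ≤ c₁‖u‖³ for all u ∈ X and ‖F(u) − F(z)‖ ≤ c₂ R² ‖u − z‖ whenever ‖u‖ ≤ R and ‖z‖ ≤ R (for every R > 0), where c₁, c₂ > 0 are constants, and let h ∈ X with ‖h‖ = 1. Then there exists ε₀ > 0 (it suffices that ε₀ < (1+c₁)⁻³ and c₂ε₀^{1/3} < 1) such that for every ε ∈ (0,ε₀) the equation u = −(1/ε)F(u) + εh has a unique solution u_ε in the ball {u : ‖u‖ ≤ ε^{2/3}}; in particular ‖u_ε‖ → 0 as ε → 0. -/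
/-- A Lipschitz map with constant `K < 1` of a nonempty complete set into itself has exactly one
fixed point in that set. -/
theorem existsUnique_fixedPoint_of_mapsTo {α : Type*} [MetricSpace α] {s : Set α}
    (hs : IsComplete s) (hne : s.Nonempty) {T : α → α} (hT : Set.MapsTo T s s) {K : ℝ}
    (hK0 : 0 ≤ K) (hK1 : K < 1) (hLip : ∀ x ∈ s, ∀ y ∈ s, dist (T x) (T y) ≤ K * dist x y) :
    ∃! x, x ∈ s ∧ x = T x := by
  obtain ⟨x₀, hx₀⟩ := hne
  have hcontr : ContractingWith ⟨K, hK0⟩ (hT.restrict T s s) :=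
    ⟨by exact_mod_cast hK1, LipschitzWith.of_dist_le_mul fun x y => hLip x x.2 y y.2⟩
  obtain ⟨x, hx, hfix, -⟩ := hcontr.exists_fixedPoint' hs hT hx₀ (edist_ne_top _ _)
  refine ⟨x, ⟨hx, hfix.eq.symm⟩, fun y ⟨hy, hyT⟩ => ?_⟩
  have hle := hLip y hy x hx
  rw [← hyT, hfix.eq] at hle
  exact dist_le_zero.mp (by nlinarith [dist_nonneg (x := y) (y := x)])

/-- The fixed-point equation of a cubically bounded map, with the small parameter written as
`t ^ 3`. -/
theorem existsUnique_cubic_fixedPoint {X : Type*} [NormedAddCommGroup X] [NormedSpace ℝ X]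
    [CompleteSpace X] {F : X → X} {c₁ c₂ t : ℝ} (hc₁ : 0 ≤ c₁) (hc₂ : 0 ≤ c₂) (ht : 0 < t)
    (hF1 : ∀ u : X, ‖F u‖ ≤ c₁ * ‖u‖ ^ 3)
    (hF2 : ∀ u z : X, ‖u‖ ≤ t ^ 2 → ‖z‖ ≤ t ^ 2 → ‖F u - F z‖ ≤ c₂ * (t ^ 2) ^ 2 * ‖u - z‖)
    {h : X} (hh : ‖h‖ ≤ 1) (ht₁ : (1 + c₁) * t ≤ 1) (ht₂ : c₂ * t < 1) :
    ∃! u : X, ‖u‖ ≤ t ^ 2 ∧ u = -(1 / t ^ 3) • F u + t ^ 3 • h := by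
  have hmaps : Set.MapsTo (fun u => -(1 / t ^ 3) • F u + t ^ 3 • h)
      (Metric.closedBall 0 (t ^ 2)) (Metric.closedBall 0 (t ^ 2)) := by
    intro u hu
    rw [mem_closedBall_zero_iff] at hu ⊢
    calc ‖-(1 / t ^ 3) • F u + t ^ 3 • h‖ ≤ 1 / t ^ 3 * ‖F u‖ + t ^ 3 * ‖h‖ := by
          refine (norm_add_le _ _).trans_eq ?_
          rw [norm_smul, norm_smul, norm_neg, Real.norm_of_nonneg (by positivity),
            Real.norm_of_nonneg (by positivity)]
      _ ≤ 1 / t ^ 3 * (c₁ * (t ^ 2) ^ 3) + t ^ 3 * 1 := by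
          gcongr
          exact (hF1 u).trans (by gcongr)
      _ = (1 + c₁) * t * t ^ 2 := by field_simp; ring
      _ ≤ t ^ 2 := mul_le_of_le_one_left (by positivity) ht₁
  have hLip : ∀ u ∈ Metric.closedBall (0 : X) (t ^ 2), ∀ z ∈ Metric.closedBall (0 : X) (t ^ 2),
      dist (-(1 / t ^ 3) • F u + t ^ 3 • h) (-(1 / t ^ 3) • F z + t ^ 3 • h)
        ≤ c₂ * t * dist u z := by
    intro u hu z hz
    rw [mem_closedBall_zero_iff] at hu hz
    rw [dist_add_right, dist_eq_norm, dist_eq_norm, ← smul_sub, norm_smul, norm_neg,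
      Real.norm_of_nonneg (by positivity)]
    calc 1 / t ^ 3 * ‖F u - F z‖ ≤ 1 / t ^ 3 * (c₂ * (t ^ 2) ^ 2 * ‖u - z‖) := by
          gcongr
          exact hF2 u z hu hz
      _ = c₂ * t * ‖u - z‖ := by field_simp
  simpa only [mem_closedBall_zero_iff] using
    existsUnique_fixedPoint_of_mapsTo Metric.isClosed_closedBall.isComplete
      (Metric.nonempty_closedBall.mpr (by positivity)) hmaps (by positivity) ht₂ hLip

/-- **Theorem 3.1 (abstract form).** If `‖F(u)‖ ≤ c₁‖u‖³`, `F` is locally Lipschitz with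
constant `c₂R²` on balls of radius `R`, and `‖h‖ = 1`, then for all sufficiently small
`ε > 0` the equation `u = -(1/ε)F(u) + εh` has a unique solution in the ball of radius
`ε^(2/3)`; in particular the solution tends to `0` in norm as `ε → 0`. -/
theorem cubic_fixed_point_theorem
    {X : Type*} [NormedAddCommGroup X] [NormedSpace ℝ X] [CompleteSpace X]
    (F : X → X) (c₁ c₂ : ℝ) (hc₁ : 0 < c₁) (hc₂ : 0 < c₂)
    (hF1 : ∀ u : X, ‖F u‖ ≤ c₁ * ‖u‖ ^ 3)
    (hF2 : ∀ R : ℝ, 0 < R → ∀ u z : X, ‖u‖ ≤ R → ‖z‖ ≤ R →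
      ‖F u - F z‖ ≤ c₂ * R ^ 2 * ‖u - z‖)
    (h : X) (hh : ‖h‖ = 1) :
    ∃ ε₀ > 0, ε₀ < ((1 + c₁) ^ 3)⁻¹ ∧ c₂ * ε₀ ^ ((1 : ℝ) / 3) < 1 ∧
      ∀ ε : ℝ, ε ∈ Set.Ioo 0 ε₀ →
        ∃! u : X, ‖u‖ ≤ ε ^ ((2 : ℝ) / 3) ∧ u = -(1 / ε) • F u + ε • h := by
  have hroot : ∀ x : ℝ, 0 ≤ x → (x ^ 3) ^ ((1 : ℝ) / 3) = x := fun x hx => by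
    rw [one_div]
    exact_mod_cast Real.pow_rpow_inv_natCast hx three_ne_zero
  obtain ⟨δ, hδ, hδ₁, hδ₂⟩ : ∃ δ : ℝ, 0 < δ ∧ δ < (1 + c₁)⁻¹ ∧ c₂ * δ < 1 := by
    refine ⟨(1 + c₁ + c₂)⁻¹, by positivity, inv_strictAnti₀ (by positivity) (by linarith), ?_⟩
    rw [← div_eq_mul_inv, div_lt_one (by positivity)]
    linarith
  refine ⟨δ ^ 3, by positivity, ?_, by rwa [hroot δ hδ.le], fun ε ⟨hε, hεδ⟩ => ?_⟩
  · rw [← inv_pow]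
    gcongr
  obtain ⟨t, ht, rfl⟩ : ∃ t : ℝ, 0 < t ∧ t ^ 3 = ε :=
    ⟨ε ^ ((3 : ℕ) : ℝ)⁻¹, by positivity, Real.rpow_inv_natCast_pow hε.le three_ne_zero⟩
  have htδ : t < δ := lt_of_pow_lt_pow_left₀ 3 hδ.le hεδ
  have hrad : (t ^ 3) ^ ((2 : ℝ) / 3) = t ^ 2 := by
    rw [show (2 : ℝ) / 3 = 1 / 3 * (2 : ℕ) by norm_num, Real.rpow_mul_natCast (by positivity),
      hroot t ht.le]
  rw [hrad]
  refine existsUnique_cubic_fixedPoint hc₁.le hc₂.le ht hF1 (hF2 (t ^ 2) (by positivity)) hh.le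
    ?_ (lt_of_le_of_lt (by gcongr) hδ₂)
  rw [mul_comm, ← le_div_iff₀ (by positivity), one_div]
  exact (htδ.trans hδ₁).le
end
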